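/- Let i, j ∈ [n−1] satisfy i ≤ j. Then (1 + s_j) · [t_i, t_j] = 0 in k[S_n] (where s_j is viewed as an element of the group algebra). -/

import Mathlib

/-- The simple transposition `s_i ∈ S_n` (1-based indexing), swapping `i` and `i+1`,
defined as the identity for `i` outside `{1, …, n-1}`. -/
def simpleTransposition (n i : ℕ) : Equiv.Perm (Fin n) :=
  if h : 1 ≤ i ∧ i < n then
    Equiv.swap ⟨i - 1, by omega⟩ ⟨i, h.2⟩
  else 1

/-- The cycle `(v ⟹ w) = s_v s_{v+1} ⋯ s_{w-1} ∈ S_n`, sending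
`v ↦ v+1 ↦ ⋯ ↦ w ↦ v` (and equal to the identity when `v = w`). -/
def cyc (n v w : ℕ) : Equiv.Perm (Fin n) :=
  ((List.range' v (w - v)).map (simpleTransposition n)).prod

/-- The somewhere-to-below shuffle `t_ℓ = Σ_{w=ℓ}^{n} (ℓ ⟹ w)` in the group
algebra `R[S_n]`. -/
noncomputable def t (R : Type*) [CommRing R] (n ℓ : ℕ) :
    MonoidAlgebra R (Equiv.Perm (Fin n)) :=
  ∑ w ∈ Finset.Icc ℓ n, MonoidAlgebra.of R (Equiv.Perm (Fin n)) (cyc n ℓ w)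

section SimpleTransposition

variable {n i j : ℕ}

theorem simpleTransposition_mul_self (n i : ℕ) :
    simpleTransposition n i * simpleTransposition n i = 1 := by
  unfold simpleTransposition
  split_ifs
  · exact Equiv.swap_mul_self _ _
  · exact one_mul 1

theorem simpleTransposition_braid (hi : 1 ≤ i) (hin : i + 1 < n) :
    simpleTransposition n i * simpleTransposition n (i + 1) * simpleTransposition n i =
      simpleTransposition n (i + 1) * simpleTransposition n i * simpleTransposition n (i + 1) := by
  have h₁ : 1 ≤ i ∧ i < n := ⟨hi, by lia⟩
  have h₂ : 1 ≤ i + 1 ∧ i + 1 < n := ⟨by lia, hin⟩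
  simp only [simpleTransposition, dif_pos h₁, dif_pos h₂, Nat.add_sub_cancel]
  generalize_proofs p q
  have hpq : (⟨i - 1, p⟩ : Fin n) ≠ ⟨i, q⟩ := by simp [Fin.ext_iff]; lia
  have hpr : (⟨i - 1, p⟩ : Fin n) ≠ ⟨i + 1, hin⟩ := by simp [Fin.ext_iff]
  have hqr : (⟨i, q⟩ : Fin n) ≠ ⟨i + 1, hin⟩ := by simp [Fin.ext_iff]
  generalize (⟨i - 1, p⟩ : Fin n) = x, (⟨i, q⟩ : Fin n) = y, (⟨i + 1, hin⟩ : Fin n) = z at *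
  rw [Equiv.swap_mul_swap_mul_swap hpq hpr, Equiv.swap_comm x y, Equiv.swap_comm y z,
    Equiv.swap_mul_swap_mul_swap hqr.symm hpr.symm, Equiv.swap_comm]

theorem simpleTransposition_commute (hij : i + 2 ≤ j) :
    Commute (simpleTransposition n i) (simpleTransposition n j) := by
  unfold simpleTransposition
  split_ifs
  · apply Equiv.Perm.Disjoint.commute
    apply Equiv.Perm.disjoint_swap_swap
    simp [Fin.ext_iff]
    lia
  all_goals simp

theorem cyc_self (n i : ℕ) : cyc n i i = 1 := by simp [cyc]

theorem cyc_eq_mul (hij : i < j) :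
    cyc n i j = simpleTransposition n i * cyc n (i + 1) j := by
  have h : j - i = (j - (i + 1)) + 1 := by lia
  simp [cyc, h, List.range'_succ]

theorem simpleTransposition_commute_cyc {k : ℕ} (hij : i + 2 ≤ j) :
    Commute (simpleTransposition n i) (cyc n j k) := by
  apply Commute.list_prod_right
  intro x hx
  obtain ⟨m, hm, rfl⟩ := List.mem_map.1 hx
  exact simpleTransposition_commute (hij.trans (List.mem_range'_1.1 hm).1)

end SimpleTransposition

section GroupAlgebra

variable (R : Type*) [CommRing R] {n i j : ℕ}

local notation "σ" i:max => MonoidAlgebra.of R (Equiv.Perm (Fin n)) (simpleTransposition n i)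

theorem t_eq_zero (h : n < i) : t R n i = 0 := by
  simp [t, Finset.Icc_eq_empty_of_lt h]

theorem t_eq_one_add (h : i ≤ n) : t R n i = 1 + σ i * t R n (i + 1) := by
  unfold t
  rw [← Finset.insert_Icc_add_one_left_eq_Icc h, Finset.sum_insert (by simp), cyc_self, map_one,
    Finset.mul_sum]
  congr 1
  refine Finset.sum_congr rfl fun w hw => ?_
  rw [cyc_eq_mul (Finset.mem_Icc.1 hw).1, map_mul]

theorem of_simpleTransposition_commute_t (hij : i + 2 ≤ j) : Commute (σ i) (t R n j) :=
  Commute.sum_right _ _ _ fun _ _ => (simpleTransposition_commute_cyc hij).map _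

theorem of_simpleTransposition_mul_self (n i : ℕ) :
    MonoidAlgebra.of R (Equiv.Perm (Fin n)) (simpleTransposition n i) *
      MonoidAlgebra.of R (Equiv.Perm (Fin n)) (simpleTransposition n i) = 1 := by
  rw [← map_mul, simpleTransposition_mul_self, map_one]

theorem of_simpleTransposition_braid (hi : 1 ≤ i) (hin : i + 1 < n) :
    σ i * σ (i + 1) * σ i = σ (i + 1) * σ i * σ (i + 1) := by
  simp only [← map_mul, simpleTransposition_braid hi hin]

/-- The product `t_{i+1} t_i` is fixed by left multiplication by `s_i`. -/
theorem of_simpleTransposition_mul_t_succ_mul_t (hi : 1 ≤ i) :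
    σ i * (t R n (i + 1) * t R n i) = t R n (i + 1) * t R n i := by
  induction hd : n - i using Nat.strong_induction_on generalizing i with | _ d ih
  rcases Nat.lt_or_ge n (i + 1) with h | h
  · simp [t_eq_zero R h]
  replace ih := ih (n - (i + 1)) (by lia) (by lia) rfl
  have hsq := of_simpleTransposition_mul_self R n i
  have hbraid : σ i * (σ (i + 1) * (σ i * (t R n (i + 2) * t R n (i + 1)))) =
      σ (i + 1) * (σ i * (t R n (i + 2) * t R n (i + 1))) := by
    rcases Nat.lt_or_ge n (i + 2) with h' | h'
    · simp [t_eq_zero R h']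
    · have := of_simpleTransposition_braid R hi h'
      calc _ = σ i * σ (i + 1) * σ i * (t R n (i + 2) * t R n (i + 1)) := by
            simp only [mul_assoc]
        _ = _ := by rw [this]; simp only [mul_assoc]; exact congrArg _ (congrArg _ ih)
  have hcomm := of_simpleTransposition_commute_t R (n := n) (le_refl (i + 2))
  have hprod : t R n (i + 1) * t R n i = (1 + σ i) * t R n (i + 1) +
      σ (i + 1) * (σ i * (t R n (i + 2) * t R n (i + 1))) := by
    calc t R n (i + 1) * t R n i
        = t R n (i + 1) + t R n (i + 1) * (σ i * t R n (i + 1)) := by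
          rw [t_eq_one_add R (by lia : i ≤ n), mul_add, mul_one]
      _ = t R n (i + 1) + (1 + σ (i + 1) * t R n (i + 2)) * (σ i * t R n (i + 1)) := by
          rw [← t_eq_one_add R h]
      _ = t R n (i + 1) + σ i * t R n (i + 1) +
            σ (i + 1) * (t R n (i + 2) * σ i) * t R n (i + 1) := by
          noncomm_ring
      _ = _ := by rw [← hcomm.eq]; noncomm_ring
  rw [hprod, mul_add, hbraid, ← mul_assoc, mul_add, mul_one, hsq, add_comm (σ i)]

theorem one_add_mul_commutator_t_succ (hi : 1 ≤ i) (hin : i + 1 < n) :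
    (1 + σ (i + 1)) * (t R n i * t R n (i + 1) - t R n (i + 1) * t R n i) = 0 := by
  have hK := of_simpleTransposition_mul_t_succ_mul_t R (n := n) (i := i + 1) (by lia)
  have hsq := of_simpleTransposition_mul_self R n (i + 1)
  have hbraid := of_simpleTransposition_braid R hi hin
  have hcomm := of_simpleTransposition_commute_t R (n := n) (le_refl (i + 2))
  have hi' := t_eq_one_add R (by lia : i ≤ n)
  have hi1 := t_eq_one_add R hin.le
  have hX : (1 + σ (i + 1)) * (σ i * σ (i + 1) - σ (i + 1) * σ i) =
      (1 + σ (i + 1)) * σ i * (σ (i + 1) - 1) := by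
    have : σ (i + 1) * (σ (i + 1) * σ i) = σ i := by rw [← mul_assoc, hsq, one_mul]
    simp only [mul_sub, add_mul, one_mul, mul_one, this, mul_assoc]
    abel
  have hbr : σ i * t R n (i + 1) - t R n (i + 1) * σ i =
      (σ i * σ (i + 1) - σ (i + 1) * σ i) * t R n (i + 2) := by
    rw [hi1]
    simp only [mul_add, add_mul, sub_mul, mul_one, one_mul, mul_assoc]
    rw [hcomm.eq]
    abel
  calc _ = (1 + σ (i + 1)) * ((σ i * t R n (i + 1) - t R n (i + 1) * σ i) * t R n (i + 1)) := by
        rw [hi']; noncomm_ring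
    _ = (1 + σ (i + 1)) * (σ i * σ (i + 1) - σ (i + 1) * σ i) *
          (t R n (i + 2) * t R n (i + 1)) := by rw [hbr]; simp only [mul_assoc]
    _ = (1 + σ (i + 1)) * σ i * (σ (i + 1) * (t R n (i + 2) * t R n (i + 1)) -
          t R n (i + 2) * t R n (i + 1)) := by
        rw [hX, mul_assoc _ (σ (i + 1) - 1), sub_mul, one_mul]
    _ = 0 := by rw [hK, sub_self, mul_zero]

end GroupAlgebra

theorem one_plus_sj_mul_comm_eq_zero
    (R : Type*) [CommRing R] (n : ℕ) (hn : 0 < n)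
    (i j : ℕ) (hi1 : 1 ≤ i) (hin : i ≤ n - 1) (hj1 : 1 ≤ j) (hjn : j ≤ n - 1)
    (hij : i ≤ j) :
    (1 + MonoidAlgebra.of R (Equiv.Perm (Fin n)) (simpleTransposition n j)) *
      (t R n i * t R n j - t R n j * t R n i) = 0 := by
  obtain rfl | hlt := hij.eq_or_lt
  · simp
  obtain rfl | hlt' := (Nat.succ_le_iff.2 hlt).eq_or_lt
  · exact one_add_mul_commutator_t_succ R hi1 (by lia)
  have ih := one_plus_sj_mul_comm_eq_zero R n hn (i + 1) j (by lia) (by lia) hj1 hjn hlt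
  set b := MonoidAlgebra.of R (Equiv.Perm (Fin n)) (simpleTransposition n j)
  set a := MonoidAlgebra.of R (Equiv.Perm (Fin n)) (simpleTransposition n i)
  have hab : Commute a b := (simpleTransposition_commute hlt').map _
  have hat : Commute a (t R n j) := of_simpleTransposition_commute_t R hlt'
  have hi : t R n i = 1 + a * t R n (i + 1) := t_eq_one_add R (by lia)
  calc (1 + b) * (t R n i * t R n j - t R n j * t R n i)
      = (1 + b) * (a * t R n (i + 1) * t R n j - t R n j * a * t R n (i + 1)) := by
        rw [hi]; noncomm_ring
    _ = (1 + b) * a * (t R n (i + 1) * t R n j - t R n j * t R n (i + 1)) := by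
        rw [← hat.eq]; noncomm_ring
    _ = a * ((1 + b) * (t R n (i + 1) * t R n j - t R n j * t R n (i + 1))) := by
        rw [← ((Commute.one_right a).add_right hab).eq, mul_assoc]
    _ = 0 := by rw [ih, mul_zero]
termination_by j - i
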